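/- arXiv:2302.01726 — 6 statements merged into one kernel-verified Lean document; each statement's English description precedes it below -/
import Mathlib

section
/- Let λ > 0 and let H : [0,∞) → ℝ be differentiable with H(t) ≥ λ for all t ≥ 0 and H'(t) ≤ λ² − H(t)² for all t ≥ 0. Then H(t) ≤ λ·coth(λt) for all t > 0. -/
/-- The hyperbolic cotangent, `coth x = cosh x / sinh x`. -/
noncomputable def Real.coth (x : ℝ) : ℝ := Real.cosh x / Real.sinh x

/-- If `λ > 0` and `H : [0,∞) → ℝ` is differentiable with `H(t) ≥ λ` and
`H'(t) ≤ λ² − H(t)²` for all `t ≥ 0`, then `H(t) ≤ λ·coth(λt)` for all `t > 0`. -/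
theorem stmt_2 (lam : ℝ) (hlam : 0 < lam) (H : ℝ → ℝ)
    (hdiff : ∀ t : ℝ, 0 ≤ t → DifferentiableAt ℝ H t)
    (hlow : ∀ t : ℝ, 0 ≤ t → lam ≤ H t)
    (hray : ∀ t : ℝ, 0 ≤ t → deriv H t ≤ lam ^ 2 - H t ^ 2) :
    ∀ t : ℝ, 0 < t → H t ≤ lam * Real.coth (lam * t) := by
  intro t ht
  have hpos : 0 < Real.sinh (lam * t) := Real.sinh_pos_iff.2 (by positivity)
  suffices h : H t * Real.sinh (lam * t) - lam * Real.cosh (lam * t) ≤ 0 by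
    rw [Real.coth, ← mul_div_assoc, le_div_iff₀ hpos]
    linarith
  have hg : ∀ x : ℝ, 0 ≤ x →
      HasDerivAt (fun x ↦ H x * Real.sinh (lam * x) - lam * Real.cosh (lam * x))
        (deriv H x * Real.sinh (lam * x) + H x * (Real.cosh (lam * x) * lam)
          - lam * (Real.sinh (lam * x) * lam)) x := by
    intro x hx
    have hl : HasDerivAt (fun x : ℝ ↦ lam * x) lam x := by
      simpa using (hasDerivAt_id x).const_mul lam
    exact ((hdiff x hx).hasDerivAt.mul hl.sinh).sub (hl.cosh.const_mul lam)
  refine le_of_forall_pos_le_add fun ε hε ↦ ?_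
  rw [zero_add]
  refine image_le_of_deriv_right_lt_deriv_boundary (a := 0) (b := t)
    (f := fun x ↦ H x * Real.sinh (lam * x) - lam * Real.cosh (lam * x))
    (B := fun _ ↦ ε) (B' := fun _ ↦ 0)
    (fun x hx ↦ (hg x hx.1).continuousAt.continuousWithinAt)
    (fun x hx ↦ (hg x hx.1).hasDerivWithinAt) ?_ (fun x ↦ hasDerivAt_const x ε) ?_
    ⟨ht.le, le_rfl⟩
  · simp only [mul_zero, Real.sinh_zero, Real.cosh_zero]
    linarith
  · intro x hx hxε
    have hs : 0 ≤ Real.sinh (lam * x) := Real.sinh_nonneg_iff.2 (mul_nonneg hlam.le hx.1)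
    have hH : 0 < H x * ε := mul_pos (hlam.trans_le (hlow x hx.1)) hε
    have hd := mul_le_mul_of_nonneg_right (hray x hx.1) hs
    rw [← hxε] at hH
    linarith
end

section
/- Let λ > 0 and let H : [0,∞) → ℝ be differentiable with H(t) ≥ λ for all t ≥ 0 and H'(t) ≤ λ² − H(t)² for all t ≥ 0. Then H is nonincreasing on [0,∞), and for every t > 0 one has 0 ≤ H(t)² − λ² ≤ λ²/sinh²(λt) and 0 ≤ H(t) − λ ≤ 2λ·e^{−2λt}/(1 − e^{−2λt}); in particular H(t) = λ + O(e^{−2λt}) and H(t)² − λ² = O(e^{−2λt}) as t → ∞. -/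
/-- A function on `[0,∞)` whose derivative is nonpositive there is nonincreasing. -/
lemma antitoneOn_Ici_of_hasDerivAt_nonpos {f f' : ℝ → ℝ}
    (hf : ∀ t, 0 ≤ t → HasDerivAt f (f' t) t) (hf' : ∀ t, 0 ≤ t → f' t ≤ 0) :
    AntitoneOn f (Set.Ici 0) := by
  refine antitoneOn_of_deriv_nonpos (convex_Ici 0)
    (fun t ht => (hf t ht).continuousAt.continuousWithinAt) ?_ ?_ <;> rw [interior_Ici]
  · exact fun t ht => (hf t (le_of_lt ht)).differentiableAt.differentiableWithinAt
  · intro t ht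
    rw [(hf t (le_of_lt ht)).deriv]
    exact hf' t (le_of_lt ht)

/-- The quantity `e^{2λt} (H - λ) / (H + λ)` is nonincreasing, hence at most `1`. -/
lemma sub_le_exp_mul_add_of_deriv_le {lam : ℝ} (hlam : 0 < lam) {H : ℝ → ℝ}
    (hdiff : ∀ t : ℝ, 0 ≤ t → DifferentiableAt ℝ H t)
    (hlow : ∀ t : ℝ, 0 ≤ t → lam ≤ H t)
    (hray : ∀ t : ℝ, 0 ≤ t → deriv H t ≤ lam ^ 2 - H t ^ 2) {t : ℝ} (ht : 0 ≤ t) :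
    H t - lam ≤ Real.exp (-2 * lam * t) * (H t + lam) := by
  have hpos : ∀ t : ℝ, 0 ≤ t → 0 < H t + lam := fun t ht => by linarith [hlow t ht]
  have hanti : AntitoneOn (fun s => Real.exp (2 * lam * s) * ((H s - lam) / (H s + lam)))
      (Set.Ici 0) := by
    refine antitoneOn_Ici_of_hasDerivAt_nonpos
      (f' := fun s => 2 * lam * Real.exp (2 * lam * s) / (H s + lam) ^ 2 *
        (deriv H s + (H s ^ 2 - lam ^ 2))) ?_ ?_
    · intro s hs
      have hH := (hdiff s hs).hasDerivAt
      have he : HasDerivAt (fun s => Real.exp (2 * lam * s))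
          (Real.exp (2 * lam * s) * (2 * lam)) s := by
        simpa using ((hasDerivAt_id s).const_mul (2 * lam)).exp
      have hne := (hpos s hs).ne'
      refine (he.mul ((hH.sub_const lam).div (hH.add_const lam) hne)).congr_deriv ?_
      simp only [Pi.div_apply]
      field_simp
      ring
    · intro s hs
      exact mul_nonpos_of_nonneg_of_nonpos (by positivity) (by linarith [hray s hs])
  have h := hanti (Set.mem_Ici.2 le_rfl) (Set.mem_Ici.2 ht) ht
  have h0 : (H 0 - lam) / (H 0 + lam) ≤ 1 := by
    rw [div_le_one (hpos 0 le_rfl)]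
    linarith
  simp only [mul_zero, Real.exp_zero, one_mul] at h
  have h1 := h.trans h0
  have hqp : Real.exp (-2 * lam * t) * Real.exp (2 * lam * t) = 1 := by
    rw [← Real.exp_add, ← Real.exp_zero]
    congr 1
    ring
  rw [← div_le_iff₀ (hpos t ht)]
  calc (H t - lam) / (H t + lam)
      = Real.exp (-2 * lam * t) * (Real.exp (2 * lam * t) * ((H t - lam) / (H t + lam))) := by
        rw [← mul_assoc, hqp, one_mul]
    _ ≤ Real.exp (-2 * lam * t) * 1 := by gcongr
    _ = Real.exp (-2 * lam * t) := mul_one _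

lemma four_mul_exp_mul_sinh_sq (x : ℝ) :
    4 * Real.exp (-2 * x) * Real.sinh x ^ 2 = (1 - Real.exp (-2 * x)) ^ 2 := by
  have h : Real.exp (-2 * x) = Real.exp (-x) ^ 2 := by
    rw [← Real.exp_nat_mul]
    congr 1
    push_cast
    ring
  have h1 : Real.exp (-x) * Real.exp x = 1 := by
    rw [← Real.exp_add]
    simp
  rw [h, Real.sinh_eq]
  calc _ = (Real.exp (-x) * Real.exp x - Real.exp (-x) ^ 2) ^ 2 := by ring
    _ = _ := by rw [h1]

/-- If `λ > 0` and `H : [0,∞) → ℝ` is differentiable with `H(t) ≥ λ` and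
`H'(t) ≤ λ² − H(t)²` for all `t ≥ 0`, then `H` is nonincreasing on `[0,∞)`, and for every
`t > 0` one has `0 ≤ H(t)² − λ² ≤ λ²/sinh²(λt)` and
`0 ≤ H(t) − λ ≤ 2λ·e^{−2λt}/(1 − e^{−2λt})`; in particular `H(t) = λ + O(e^{−2λt})` and
`H(t)² − λ² = O(e^{−2λt})` as `t → ∞`. -/
theorem stmt_3 (lam : ℝ) (hlam : 0 < lam) (H : ℝ → ℝ)
    (hdiff : ∀ t : ℝ, 0 ≤ t → DifferentiableAt ℝ H t)
    (hlow : ∀ t : ℝ, 0 ≤ t → lam ≤ H t)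
    (hray : ∀ t : ℝ, 0 ≤ t → deriv H t ≤ lam ^ 2 - H t ^ 2) :
    AntitoneOn H (Set.Ici (0 : ℝ)) ∧
    (∀ t : ℝ, 0 < t →
      0 ≤ H t ^ 2 - lam ^ 2 ∧
      H t ^ 2 - lam ^ 2 ≤ lam ^ 2 / Real.sinh (lam * t) ^ 2 ∧
      0 ≤ H t - lam ∧
      H t - lam ≤ 2 * lam * Real.exp (-2 * lam * t) / (1 - Real.exp (-2 * lam * t))) ∧
    (∃ C t₀ : ℝ, 0 < C ∧ ∀ t : ℝ, t₀ < t →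
      |H t - lam| ≤ C * Real.exp (-2 * lam * t) ∧
      |H t ^ 2 - lam ^ 2| ≤ C * Real.exp (-2 * lam * t)) := by
  have key : ∀ t : ℝ, 0 < t →
      H t - lam ≤ 2 * lam * Real.exp (-2 * lam * t) / (1 - Real.exp (-2 * lam * t)) := by
    intro t ht
    have hq : Real.exp (-2 * lam * t) < 1 := Real.exp_lt_one_iff.2 (by nlinarith [mul_pos hlam ht])
    rw [le_div_iff₀ (by linarith)]
    linarith [sub_le_exp_mul_add_of_deriv_le hlam hdiff hlow hray ht.le]
  refine ⟨antitoneOn_Ici_of_hasDerivAt_nonpos (fun t ht => (hdiff t ht).hasDerivAt) fun t ht => ?_,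
    fun t ht => ⟨?_, ?_, ?_, key t ht⟩, 4 * lam + 16 * lam ^ 2, 1 / lam, by positivity,
    fun t ht => ?_⟩
  · nlinarith [hray t ht, hlow t ht]
  · nlinarith [hlow t ht.le]
  · have hq : Real.exp (-2 * lam * t) < 1 := Real.exp_lt_one_iff.2 (by nlinarith [mul_pos hlam ht])
    have hsinh : 0 < Real.sinh (lam * t) := Real.sinh_pos_iff.2 (mul_pos hlam ht)
    have hid := four_mul_exp_mul_sinh_sq (lam * t)
    rw [← mul_assoc] at hid
    have hk := key t ht
    have hl := hlow t ht.le
    have hq0 := Real.exp_pos (-2 * lam * t)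
    generalize Real.exp (-2 * lam * t) = q at *
    have hq1 : 0 < 1 - q := by linarith
    have hk' : H t + lam ≤ 2 * lam / (1 - q) := by
      have : 2 * lam / (1 - q) = 2 * lam * q / (1 - q) + 2 * lam := by
        field_simp
        ring
      linarith
    calc H t ^ 2 - lam ^ 2 = (H t - lam) * (H t + lam) := by ring
      _ ≤ (2 * lam * q / (1 - q)) * (2 * lam / (1 - q)) := by
        gcongr
        linarith
      _ = lam ^ 2 * (4 * q) / (1 - q) ^ 2 := by
        field_simp
        ring
      _ = lam ^ 2 / Real.sinh (lam * t) ^ 2 := by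
        rw [← hid]
        field_simp
  · linarith [hlow t ht.le]
  · have ht0 : 0 < t := lt_trans (by positivity) ht
    have hlt : 1 < lam * t := by
      rw [div_lt_iff₀ hlam] at ht
      linarith
    have hq : Real.exp (-2 * lam * t) ≤ 1 / 2 := by
      have h2 : 2 ≤ Real.exp (2 * lam * t) := by linarith [Real.add_one_le_exp (2 * lam * t)]
      have : -2 * lam * t = -(2 * lam * t) := by ring
      rw [this, Real.exp_neg, ← one_div]
      exact one_div_le_one_div_of_le two_pos h2
    have hk := sub_le_exp_mul_add_of_deriv_le hlam hdiff hlow hray ht0.le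
    have hl := hlow t ht0.le
    have hq0 := Real.exp_pos (-2 * lam * t)
    generalize Real.exp (-2 * lam * t) = q at *
    have hx : H t - lam ≤ 4 * lam * q := by nlinarith
    have hy : H t + lam ≤ 4 * lam := by nlinarith
    rw [abs_of_nonneg (by linarith), abs_of_nonneg (by nlinarith)]
    constructor
    · nlinarith [mul_pos (pow_pos hlam 2) hq0]
    · calc H t ^ 2 - lam ^ 2 = (H t - lam) * (H t + lam) := by ring
        _ ≤ (4 * lam * q) * (4 * lam) := by
          gcongr
          linarith
        _ ≤ (4 * lam + 16 * lam ^ 2) * q := by nlinarith [mul_pos hlam hq0]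
end

section
/- Let λ > 0 and let H : [0,∞) → ℝ be continuous with λ ≤ H(t) ≤ H(0) for all t ≥ 0 and H(t) ≤ λ·coth(λt) for all t > 0. Let L₀ > 0 and define the length scale L(t) := L₀·exp(∫₀ᵗ H(s) ds). Then L₀·e^{λt} ≤ L(t) for all t ≥ 0, and there exists a constant C > 0 such that L(t) ≤ C·e^{λt} for all t ≥ 0. -/
/-- The logarithmic derivative of `s ↦ sinh (lam * s)`. -/
theorem hasDerivAt_log_sinh_mul {lam s : ℝ} (hs : 0 < lam * s) :
    HasDerivAt (fun s : ℝ => Real.log (Real.sinh (lam * s))) (lam * Real.coth (lam * s)) s := by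
  have h := (((hasDerivAt_id' s).const_mul lam).sinh).log (Real.sinh_pos_iff.2 hs).ne'
  have hderiv : Real.cosh (lam * s) * (lam * 1) / Real.sinh (lam * s) =
      lam * Real.coth (lam * s) := by
    rw [Real.coth]
    ring
  exact hderiv ▸ h

theorem continuousOn_coth_mul {lam : ℝ} {S : Set ℝ} (hS : ∀ s ∈ S, 0 < lam * s) :
    ContinuousOn (fun s : ℝ => lam * Real.coth (lam * s)) S := by
  unfold Real.coth
  refine continuousOn_const.mul (ContinuousOn.div ?_ ?_ fun s hs => ?_)
  · exact (Real.continuous_cosh.comp (continuous_const.mul continuous_id)).continuousOn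
  · exact (Real.continuous_sinh.comp (continuous_const.mul continuous_id)).continuousOn
  · exact (Real.sinh_pos_iff.2 (hS s hs)).ne'

theorem integral_coth_mul_le {lam a b : ℝ} (hlam : 0 < lam) (ha : 0 < a) (hab : a ≤ b) :
    ∫ s in a..b, lam * Real.coth (lam * s) ≤ lam * b - Real.log (Real.sinh (lam * a)) := by
  have hpos : ∀ s ∈ Set.uIcc a b, 0 < lam * s := fun s hs => by
    rw [Set.uIcc_of_le hab] at hs
    exact mul_pos hlam (ha.trans_le hs.1)
  rw [intervalIntegral.integral_eq_sub_of_hasDerivAt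
    (fun s hs => hasDerivAt_log_sinh_mul (hpos s hs))
    (continuousOn_coth_mul hpos).intervalIntegrable]
  have hb : 0 < Real.sinh (lam * b) := Real.sinh_pos_iff.2 (hpos b Set.right_mem_uIcc)
  have h : Real.log (Real.sinh (lam * b)) ≤ lam * b := by
    rw [Real.log_le_iff_le_exp hb, Real.sinh_eq]
    linarith [Real.exp_pos (lam * b), Real.exp_pos (-(lam * b))]
  linarith

/-- Let `λ > 0` and `H : [0,∞) → ℝ` continuous with
`λ ≤ H(t) ≤ H(0)` for all `t ≥ 0` and `H(t) ≤ λ·coth(λt)` for `t > 0`.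
Let `L₀ > 0` and `L(t) := L₀·exp(∫₀ᵗ H(s) ds)`. Then `L₀·e^{λt} ≤ L(t)` for all `t ≥ 0`,
and there is `C > 0` with `L(t) ≤ C·e^{λt}` for all `t ≥ 0`. -/
theorem stmt_4 (lam L₀ : ℝ) (hlam : 0 < lam) (hL₀ : 0 < L₀)
    (H : ℝ → ℝ) (hcont : ContinuousOn H (Set.Ici (0 : ℝ)))
    (hbound : ∀ t : ℝ, 0 ≤ t → lam ≤ H t ∧ H t ≤ H 0)
    (hcoth : ∀ t : ℝ, 0 < t → H t ≤ lam * Real.coth (lam * t))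
    (L : ℝ → ℝ)
    (hL : ∀ t : ℝ, L t = L₀ * Real.exp (∫ s in (0:ℝ)..t, H s)) :
    (∀ t : ℝ, 0 ≤ t → L₀ * Real.exp (lam * t) ≤ L t) ∧
    ∃ C : ℝ, 0 < C ∧ ∀ t : ℝ, 0 ≤ t → L t ≤ C * Real.exp (lam * t) := by
  have hint : ∀ a b : ℝ, 0 ≤ a → a ≤ b → IntervalIntegrable H MeasureTheory.volume a b :=
    fun a b ha hab => by
      refine (hcont.mono fun s hs => ?_).intervalIntegrable
      rw [Set.uIcc_of_le hab] at hs
      exact ha.trans hs.1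
  have hupper : ∀ t : ℝ, 0 ≤ t → ∫ s in (0:ℝ)..t, H s ≤ H 0 * t := fun t ht => by
    have h := intervalIntegral.integral_mono_on ht (hint 0 t le_rfl ht)
      (intervalIntegrable_const (c := H 0)) fun s hs => (hbound s hs.1).2
    rw [intervalIntegral.integral_const, smul_eq_mul] at h
    linarith
  have hH0 : 0 < H 0 := hlam.trans_le (hbound 0 le_rfl).1
  refine ⟨fun t ht => ?_, ?_⟩
  · have h := intervalIntegral.integral_mono_on ht (intervalIntegrable_const (c := lam))
      (hint 0 t le_rfl ht) fun s hs => (hbound s hs.1).1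
    rw [intervalIntegral.integral_const, smul_eq_mul] at h
    rw [hL]
    gcongr
    linarith
  · refine ⟨L₀ * Real.exp (H 0 + |Real.log (Real.sinh (lam * 1))|), by positivity, fun t ht => ?_⟩
    rw [hL, mul_assoc, ← Real.exp_add]
    gcongr
    rcases le_total t 1 with h1 | h1
    · nlinarith [hupper t ht, abs_nonneg (Real.log (Real.sinh (lam * 1))), mul_nonneg hlam.le ht]
    · rw [← intervalIntegral.integral_add_adjacent_intervals (hint 0 1 le_rfl zero_le_one)
        (hint 1 t zero_le_one h1)]
      have hpos : ∀ s ∈ Set.uIcc 1 t, 0 < lam * s := fun s hs => by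
        rw [Set.uIcc_of_le h1] at hs
        exact mul_pos hlam (zero_lt_one.trans_le hs.1)
      have h := intervalIntegral.integral_mono_on h1 (hint 1 t zero_le_one h1)
        (continuousOn_coth_mul hpos).intervalIntegrable
        fun s hs => hcoth s (zero_lt_one.trans_le hs.1)
      linarith [hupper 1 zero_le_one, integral_coth_mul_le hlam one_pos h1,
        neg_abs_le (Real.log (Real.sinh (lam * 1)))]
end

section
/- Let λ > 0, C ≥ 0 and let H : [0,∞) → ℝ be continuous with λ ≤ H(t) ≤ H(0) for all t ≥ 0 and H(t) ≤ λ·coth(λt) for all t > 0. Let f : [0,∞) → ℝ be differentiable with |f'(t) + 3·H(t)·f(t)| ≤ C·e^{−2λt} for all t ≥ 0. Then there exists C' > 0 such that |f(t)| ≤ C'·e^{−2λt} for all t ≥ 0. -/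
/-- One-sided decay estimate for `f' + 3 H f ≤ C e^{-2λt}` with `H ≥ λ`, via a constant barrier for
`f e^{2λt}`. -/
theorem le_mul_exp_of_deriv_add_le {lam C B : ℝ} {H f : ℝ → ℝ}
    (hH : ∀ t : ℝ, 0 ≤ t → lam ≤ H t)
    (hdiff : ∀ t : ℝ, 0 ≤ t → DifferentiableAt ℝ f t)
    (hbound : ∀ t : ℝ, 0 ≤ t → deriv f t + 3 * H t * f t ≤ C * Real.exp (-2 * lam * t))
    (hB : 0 < B) (hf : f 0 ≤ B) (hCB : C < lam * B) {t : ℝ} (ht : 0 ≤ t) :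
    f t ≤ B * Real.exp (-2 * lam * t) := by
  have hexp (x : ℝ) : Real.exp (-2 * lam * x) * Real.exp (2 * lam * x) = 1 := by
    rw [← Real.exp_add, ← Real.exp_zero]; ring_nf
  have hg : ∀ x : ℝ, 0 ≤ x → HasDerivAt (fun s => f s * Real.exp (2 * lam * s))
      (deriv f x * Real.exp (2 * lam * x) + f x * (Real.exp (2 * lam * x) * (2 * lam))) x := by
    intro x hx
    have he : HasDerivAt (fun s : ℝ => 2 * lam * s) (2 * lam) x := by
      simpa using (hasDerivAt_id x).const_mul (2 * lam)
    exact (hdiff x hx).hasDerivAt.mul he.exp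
  have key : f t * Real.exp (2 * lam * t) ≤ B := by
    refine image_le_of_deriv_right_lt_deriv_boundary (a := 0) (b := t) (B := fun _ => B)
      (B' := fun _ => 0)
      (fun x hx => (hg x hx.1).continuousAt.continuousWithinAt)
      (fun x hx => (hg x hx.1).hasDerivWithinAt) (by simpa using hf)
      (fun x => hasDerivAt_const x B) ?_ ⟨ht, le_rfl⟩
    intro x hx hxB
    have h1 := mul_le_mul_of_nonneg_right (hbound x hx.1) (Real.exp_pos (2 * lam * x)).le
    rw [mul_assoc C, hexp, mul_one] at h1
    have h2 := mul_le_mul_of_nonneg_right (hH x hx.1) hB.le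
    have h3 : (deriv f x + 3 * H x * f x) * Real.exp (2 * lam * x)
        = deriv f x * Real.exp (2 * lam * x) + 3 * (H x * B) := by rw [← hxB]; ring
    have h4 : f x * (Real.exp (2 * lam * x) * (2 * lam)) = 2 * (lam * B) := by rw [← hxB]; ring
    linarith
  calc f t = f t * Real.exp (2 * lam * t) * Real.exp (-2 * lam * t) := by
        rw [mul_assoc, mul_comm (Real.exp (2 * lam * t)), hexp, mul_one]
    _ ≤ B * Real.exp (-2 * lam * t) := by gcongr

/-- Let `λ > 0`, `C ≥ 0` and `H : [0,∞) → ℝ` continuous with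
`λ ≤ H(t) ≤ H(0)` for all `t ≥ 0` and `H(t) ≤ λ·coth(λt)` for all `t > 0`. Let
`f : [0,∞) → ℝ` be differentiable with `|f'(t) + 3·H(t)·f(t)| ≤ C·e^{−2λt}` for all `t ≥ 0`.
Then there is `C' > 0` with `|f(t)| ≤ C'·e^{−2λt}` for all `t ≥ 0`. -/
theorem stmt_9 (lam C : ℝ) (hlam : 0 < lam) (hC : 0 ≤ C)
    (H : ℝ → ℝ) (hcont : ContinuousOn H (Set.Ici (0 : ℝ)))
    (hH : ∀ t : ℝ, 0 ≤ t → lam ≤ H t ∧ H t ≤ H 0)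
    (hcoth : ∀ t : ℝ, 0 < t → H t ≤ lam * Real.coth (lam * t))
    (f : ℝ → ℝ)
    (hdiff : ∀ t : ℝ, 0 ≤ t → DifferentiableAt ℝ f t)
    (hbound : ∀ t : ℝ, 0 ≤ t →
      |deriv f t + 3 * H t * f t| ≤ C * Real.exp (-2 * lam * t)) :
    ∃ C' : ℝ, 0 < C' ∧ ∀ t : ℝ, 0 ≤ t → |f t| ≤ C' * Real.exp (-2 * lam * t) := by
  have hq : 0 ≤ C / lam := by positivity
  have hB : 0 < |f 0| + C / lam + 1 := by positivity
  have hCB : C < lam * (|f 0| + C / lam + 1) := by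
    have h : lam * (C / lam) = C := by field_simp
    nlinarith [mul_nonneg hlam.le (abs_nonneg (f 0))]
  refine ⟨|f 0| + C / lam + 1, hB, fun t ht => abs_le'.2 ⟨?_, ?_⟩⟩
  · exact le_mul_exp_of_deriv_add_le (fun s hs => (hH s hs).1) hdiff
      (fun s hs => (abs_le'.1 (hbound s hs)).1) hB (by linarith [le_abs_self (f 0)]) hCB ht
  · refine le_mul_exp_of_deriv_add_le (f := fun s => -f s) (fun s hs => (hH s hs).1)
      (fun s hs => (hdiff s hs).fun_neg)
      (fun s hs => ?_) hB (by linarith [neg_le_abs (f 0)]) hCB ht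
    rw [deriv.fun_neg]
    linarith [(abs_le'.1 (hbound s hs)).2]
end

section
/- Let λ > 0, γ ∈ [2/3, 2], C₀, C₁, C₂ ≥ 0, and let H : [0,∞) → ℝ be continuous with λ ≤ H(t) ≤ H(0) for all t ≥ 0 and H(t) ≤ λ·coth(λt) for t > 0. Let ρ : [0,∞) → ℝ be differentiable with ρ(t) ≥ 0, ρ(t) ≤ C₀·e^{−2λt}, and |ρ'(t) + 3γ·H(t)·ρ(t)| ≤ C₁·ρ(t)² + C₂·ρ(t)·e^{−λt} for all t ≥ 0. Then there exists C > 0 such that ρ(t) ≤ C·e^{−3γλt} for all t ≥ 0. -/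
/-- Grönwall estimate with an exponentially decaying perturbation of the decay rate. -/
theorem le_mul_exp_of_deriv_le_exp_perturbation {f : ℝ → ℝ} {a b K : ℝ} (hb : 0 < b) (hK : 0 ≤ K)
    (hdiff : ∀ t : ℝ, 0 ≤ t → DifferentiableAt ℝ f t) (hf : ∀ t : ℝ, 0 ≤ t → 0 ≤ f t)
    (hderiv : ∀ t : ℝ, 0 ≤ t → deriv f t ≤ (-a + K * Real.exp (-b * t)) * f t)
    {t : ℝ} (ht : 0 ≤ t) :
    f t ≤ f 0 * Real.exp (K / b) * Real.exp (-a * t) := by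
  set φ : ℝ → ℝ := fun s => a * s + K / b * Real.exp (-b * s) with hφ
  have hφd (s : ℝ) : HasDerivAt φ (a - K * Real.exp (-b * s)) s := by
    have h := ((hasDerivAt_id' s).const_mul a).add
      ((((hasDerivAt_id' s).const_mul (-b)).exp).const_mul (K / b))
    refine h.congr_deriv ?_
    field_simp
    ring
  have hg (s : ℝ) (hs : 0 ≤ s) : HasDerivAt (fun s => f s * Real.exp (φ s))
      (deriv f s * Real.exp (φ s) +
        f s * (Real.exp (φ s) * (a - K * Real.exp (-b * s)))) s :=
    (hdiff s hs).hasDerivAt.mul (hφd s).exp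
  have hanti : AntitoneOn (fun s => f s * Real.exp (φ s)) (Set.Ici 0) := by
    refine antitoneOn_of_deriv_nonpos (convex_Ici 0)
      (fun s hs => (hg s hs).continuousAt.continuousWithinAt)
      (fun s hs => (hg s (interior_subset hs)).differentiableAt.differentiableWithinAt)
      (fun s hs => ?_)
    have hs' : 0 ≤ s := interior_subset hs
    rw [(hg s hs').deriv]
    nlinarith [mul_le_mul_of_nonneg_right (hderiv s hs') (Real.exp_pos (φ s)).le]
  have h0 : f t * Real.exp (φ t) ≤ f 0 * Real.exp (K / b) := by
    simpa [hφ] using hanti Set.self_mem_Ici ht ht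
  have hle : Real.exp (a * t) ≤ Real.exp (φ t) := by
    apply Real.exp_le_exp.mpr
    simp only [hφ]
    have : 0 ≤ K / b * Real.exp (-b * t) := by positivity
    linarith
  have h1 := (mul_le_mul_of_nonneg_left hle (hf t ht)).trans h0
  rwa [neg_mul, Real.exp_neg, ← div_eq_mul_inv, le_div_iff₀ (Real.exp_pos _)]

/-- Let `λ > 0`, `γ ∈ [2/3, 2]`, `C₀, C₁, C₂ ≥ 0`, and `H : [0,∞) → ℝ`
continuous with `λ ≤ H(t) ≤ H(0)` for all `t ≥ 0` and `H(t) ≤ λ·coth(λt)` for `t > 0`.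
Let `ρ : [0,∞) → ℝ` be differentiable with `ρ(t) ≥ 0`, `ρ(t) ≤ C₀·e^{−2λt}`, and
`|ρ'(t) + 3γ·H(t)·ρ(t)| ≤ C₁·ρ(t)² + C₂·ρ(t)·e^{−λt}` for all `t ≥ 0`. Then there is
`C > 0` with `ρ(t) ≤ C·e^{−3γλt}` for all `t ≥ 0`. -/
theorem stmt_12 (lam γ C₀ C₁ C₂ : ℝ) (hlam : 0 < lam)
    (hγ : γ ∈ Set.Icc (2/3 : ℝ) 2)
    (hC₀ : 0 ≤ C₀) (hC₁ : 0 ≤ C₁) (hC₂ : 0 ≤ C₂)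
    (H : ℝ → ℝ) (hHcont : ContinuousOn H (Set.Ici (0 : ℝ)))
    (hH : ∀ t : ℝ, 0 ≤ t → lam ≤ H t ∧ H t ≤ H 0)
    (hcoth : ∀ t : ℝ, 0 < t → H t ≤ lam * Real.coth (lam * t))
    (ρ : ℝ → ℝ)
    (hdiff : ∀ t : ℝ, 0 ≤ t → DifferentiableAt ℝ ρ t)
    (hρpos : ∀ t : ℝ, 0 ≤ t → 0 ≤ ρ t)
    (hρdecay : ∀ t : ℝ, 0 ≤ t → ρ t ≤ C₀ * Real.exp (-2 * lam * t))
    (hev : ∀ t : ℝ, 0 ≤ t →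
      |deriv ρ t + 3 * γ * H t * ρ t| ≤ C₁ * ρ t ^ 2 + C₂ * ρ t * Real.exp (-lam * t)) :
    ∃ C : ℝ, 0 < C ∧ ∀ t : ℝ, 0 ≤ t → ρ t ≤ C * Real.exp (-3 * γ * lam * t) := by
  have hγ0 : 0 ≤ γ := by linarith [hγ.1]
  refine ⟨ρ 0 * Real.exp ((C₁ * C₀ + C₂) / lam) + 1, ?_, fun t ht => ?_⟩
  · have := hρpos 0 le_rfl
    positivity
  have key := le_mul_exp_of_deriv_le_exp_perturbation (f := ρ) (a := 3 * γ * lam)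
    (K := C₁ * C₀ + C₂) hlam (by positivity) hdiff hρpos (fun s hs => ?_) ht
  · rw [show -3 * γ * lam * t = -(3 * γ * lam) * t by ring]
    nlinarith [Real.exp_pos (-(3 * γ * lam) * t)]
  have hr := hρpos s hs
  have hupper := (abs_le.mp (hev s hs)).2
  have hexp : Real.exp (-2 * lam * s) ≤ Real.exp (-lam * s) :=
    Real.exp_le_exp.mpr (by nlinarith [mul_nonneg hlam.le hs])
  have hbound : ρ s ≤ C₀ * Real.exp (-lam * s) :=
    (hρdecay s hs).trans (mul_le_mul_of_nonneg_left hexp hC₀)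
  have hquad := mul_le_mul_of_nonneg_left hbound (mul_nonneg hC₁ hr)
  have hHlam := mul_le_mul_of_nonneg_left (hH s hs).1 (mul_nonneg hγ0 hr)
  linarith
end

section
/- Let n be a symmetric real 3×3 matrix and a ∈ ℝ³ a vector with Σ_β n_{αβ}·a_β = 0 for every α. Let ε_{αβγ} denote the Levi-Civita symbol on three indices (ε_{123} = 1, totally antisymmetric), δ_{αβ} the Kronecker delta, and define S_{αβ} := 2·Σ_γ n_{αγ}n_{γβ} − (Σ_γ n_{γγ})·n_{αβ} − (1/3)·δ_{αβ}·(2·Σ_{γ,δ} n_{γδ}n_{γδ} − (Σ_γ n_{γγ})²) + Σ_{γ,δ} ε_{γδα}·a_γ·n_{βδ} + Σ_{γ,δ} ε_{γδβ}·a_γ·n_{αδ}. Then for every β: 3·Σ_α a_α·S_{αβ} + Σ_{α,ε,δ} ε_{αβδ}·S_{αε}·n_{εδ} = 0. -/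
/-- The Levi-Civita symbol on three indices: `ε 0 1 2 = 1`, totally antisymmetric,
zero when two indices coincide. -/
noncomputable def leviCivita3 (i j k : Fin 3) : ℝ :=
  (((j : ℕ) : ℝ) - ((i : ℕ) : ℝ)) * (((k : ℕ) : ℝ) - ((j : ℕ) : ℝ)) *
    (((k : ℕ) : ℝ) - ((i : ℕ) : ℝ)) / 2

/-- Let `n` be a symmetric real 3×3 matrix and `a ∈ ℝ³` with
`Σ_β n_{αβ}·a_β = 0` for every `α`. With `ε` the Levi-Civita symbol, `δ` the Kronecker
delta, and `S_{αβ}` the trace-free 3-Ricci curvature expression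
`S_{αβ} = 2Σ_γ n_{αγ}n_{γβ} − (tr n)·n_{αβ} − (1/3)δ_{αβ}(2Σ n_{γδ}n_{γδ} − (tr n)²)
 + Σ_{γ,δ} ε_{γδα}a_γ n_{βδ} + Σ_{γ,δ} ε_{γδβ}a_γ n_{αδ}`,
one has, for every `β`: `3·Σ_α a_α·S_{αβ} + Σ_{α,ε,δ} ε_{αβδ}·S_{αε}·n_{εδ} = 0`. -/
theorem stmt_16 (n : Matrix (Fin 3) (Fin 3) ℝ) (hsymm : ∀ α β, n α β = n β α)
    (a : Fin 3 → ℝ) (hna : ∀ α, ∑ β, n α β * a β = 0)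
    (S : Matrix (Fin 3) (Fin 3) ℝ)
    (hS : ∀ α β, S α β =
      2 * (∑ γ, n α γ * n γ β) - (∑ γ, n γ γ) * n α β
        - (1/3) * (if α = β then (1:ℝ) else 0) *
            (2 * (∑ γ, ∑ δ, n γ δ * n γ δ) - (∑ γ, n γ γ) ^ 2)
        + (∑ γ, ∑ δ, leviCivita3 γ δ α * a γ * n β δ)
        + (∑ γ, ∑ δ, leviCivita3 γ δ β * a γ * n α δ)) :
    ∀ β, 3 * (∑ α, a α * S α β) +
      (∑ α, ∑ e, ∑ δ, leviCivita3 α β δ * S α e * n e δ) = 0 := by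
  have h10 := hsymm 1 0
  have h20 := hsymm 2 0
  have h21 := hsymm 2 1
  have h0 := hna 0
  have h1 := hna 1
  have h2 := hna 2
  simp only [Fin.sum_univ_three, h10, h20, h21] at h0 h1 h2
  intro β
  fin_cases β <;>
    simp [Fin.sum_univ_three, hS, leviCivita3, h10, h20, h21]
  · linear_combination 3 * (n 0 0 * h0 + n 0 1 * h1 + n 0 2 * h2)
      - (n 0 0 + n 1 1 + n 2 2) * h0 + 3 * (a 1 * h2 - a 2 * h1)
  · linear_combination 3 * (n 0 1 * h0 + n 1 1 * h1 + n 1 2 * h2)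
      - (n 0 0 + n 1 1 + n 2 2) * h1 + 3 * (a 2 * h0 - a 0 * h2)
  · linear_combination 3 * (n 0 2 * h0 + n 1 2 * h1 + n 2 2 * h2)
      - (n 0 0 + n 1 1 + n 2 2) * h2 + 3 * (a 0 * h1 - a 1 * h0)
end
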